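/- arXiv:2406.19278 — 7 statements merged into one kernel-verified Lean document; each statement's English description precedes it below -/
import Mathlib

section
/- Every connected graph G on at least three vertices having no open twins of degree 1 admits a locating-dominating set S of minimum cardinality (i.e., |S| = γ^LD(G)) such that S contains no leaves of G. -/
open SimpleGraph

/-- The closed neighbourhood `N[v] = N(v) ∪ {v}` of a vertex. -/
def closedNbhd {V : Type*} (G : SimpleGraph V) (v : V) : Set V :=
  insert v (G.neighborSet v)

/-- The degree of a vertex, as the cardinality of its open neighbourhood. -/
noncomputable def deg {V : Type*} (G : SimpleGraph V) (v : V) : ℕ :=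
  (G.neighborSet v).ncard

/-- `S` is a dominating set: every vertex has a member of `S` in its closed neighbourhood. -/
def IsDominating {V : Type*} (G : SimpleGraph V) (S : Set V) : Prop :=
  ∀ v : V, (closedNbhd G v ∩ S).Nonempty

/-- `S` is a locating-dominating set: it dominates and separates all pairs of
vertices outside `S` by their closed neighbourhoods intersected with `S`. -/
def IsLDSet {V : Type*} (G : SimpleGraph V) (S : Set V) : Prop :=
  IsDominating G S ∧
    ∀ u ∉ S, ∀ v ∉ S, u ≠ v → closedNbhd G u ∩ S ≠ closedNbhd G v ∩ S

/-- The location-domination number `γ^LD(G)`. -/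
noncomputable def ldNum {V : Type*} (G : SimpleGraph V) : ℕ :=
  sInf {k : ℕ | ∃ S : Set V, IsLDSet G S ∧ S.ncard = k}

/-- A graph is subcubic if every vertex has degree at most 3. -/
def Subcubic {V : Type*} (G : SimpleGraph V) : Prop :=
  ∀ v : V, deg G v ≤ 3

/-- `u` and `v` are open twins: distinct vertices with the same open neighbourhood. -/
def OpenTwins {V : Type*} (G : SimpleGraph V) (u v : V) : Prop :=
  u ≠ v ∧ G.neighborSet u = G.neighborSet v

/-- `u` and `v` are closed twins: distinct vertices with the same closed neighbourhood. -/
def ClosedTwins {V : Type*} (G : SimpleGraph V) (u v : V) : Prop :=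
  u ≠ v ∧ closedNbhd G u = closedNbhd G v

/-- A graph is twin-free if it has neither open twins nor closed twins. -/
def TwinFree {V : Type*} (G : SimpleGraph V) : Prop :=
  (¬ ∃ u v : V, OpenTwins G u v) ∧ (¬ ∃ u v : V, ClosedTwins G u v)

theorem mem_closedNbhd {V : Type*} {G : SimpleGraph V} {v x : V} :
    x ∈ closedNbhd G v ↔ x = v ∨ G.Adj v x := by
  simp [closedNbhd]

theorem exists_support_of_deg_eq_one {V : Type*} {G : SimpleGraph V} {l : V}
    (hl : deg G l = 1) : ∃ w, ∀ x, G.Adj l x ↔ x = w := by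
  obtain ⟨w, hw⟩ := Set.ncard_eq_one.mp hl
  exact ⟨w, fun x => by rw [← mem_neighborSet, hw, Set.mem_singleton_iff]⟩

/-- In a connected graph on at least three vertices, the neighbour of a leaf is not a leaf. -/
theorem deg_support_ne_one {V : Type*} [Fintype V] {G : SimpleGraph V}
    (hn : 3 ≤ Fintype.card V) (hconn : G.Connected) {l w : V}
    (hw : ∀ x, G.Adj l x ↔ x = w) : deg G w ≠ 1 := by
  intro h
  obtain ⟨m, hm⟩ := exists_support_of_deg_eq_one h
  obtain rfl : l = m := (hm l).mp ((hw w).mpr rfl).symm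
  have key : ∀ {a b : V}, G.Walk a b → (a = l ∨ a = w) → (b = l ∨ b = w) := by
    intro a b p
    induction p with
    | nil => exact id
    | cons hadj _ ih =>
      rintro (rfl | rfl)
      · exact ih (Or.inr ((hw _).mp hadj))
      · exact ih (Or.inl ((hm _).mp hadj))
  classical
  have hsub : (Finset.univ : Finset V) ⊆ {l, w} := by
    intro b _
    obtain ⟨p⟩ := hconn.preconnected l b
    simpa using key p (Or.inl rfl)
  have hcard := (Finset.card_le_card hsub).trans Finset.card_le_two
  rw [Finset.card_univ] at hcard
  omega

theorem ldNum_le {V : Type*} {G : SimpleGraph V} {S : Set V} (hS : IsLDSet G S) :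
    ldNum G ≤ S.ncard :=
  Nat.sInf_le ⟨S, hS, rfl⟩

theorem exists_isLDSet_ncard_eq_ldNum {V : Type*} (G : SimpleGraph V) :
    ∃ S : Set V, IsLDSet G S ∧ S.ncard = ldNum G := by
  refine Nat.sInf_mem (s := {k : ℕ | ∃ S : Set V, IsLDSet G S ∧ S.ncard = k})
    ⟨_, Set.univ, ⟨fun v => ⟨v, ?_, trivial⟩, fun u hu => absurd trivial hu⟩, rfl⟩
  exact mem_closedNbhd.mpr (Or.inl rfl)

/-- Criterion for removing a leaf `l` with neighbour `w` from a locating-dominating set `S`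
while adding the vertices of `T`: it suffices that `w` is in the new set, and that no vertex
outside it other than `l` has `w` as its only neighbour in it. -/
theorem IsLDSet.sdiff_leaf_union {V : Type*} {G : SimpleGraph V} {S T : Set V} {l w : V}
    (hS : IsLDSet G S) (hw : ∀ x, G.Adj l x ↔ x = w) (hlT : l ∉ T)
    (hwS : w ∈ S ∪ T)
    (hsep : ∀ y ∉ S ∪ T, closedNbhd G y ∩ (S \ {l} ∪ T) ≠ {w}) :
    IsLDSet G (S \ {l} ∪ T) := by
  have hlw : G.Adj l w := (hw w).mpr rfl
  have hwl : w ≠ l := hlw.ne'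
  have hw' : w ∈ S \ {l} ∪ T := hwS.imp (fun h => ⟨h, hwl⟩) id
  have hl : closedNbhd G l ∩ (S \ {l} ∪ T) = {w} := by
    ext x
    simp only [Set.mem_inter_iff, mem_closedNbhd, hw, Set.mem_singleton_iff]
    constructor
    · rintro ⟨rfl | rfl, h⟩
      · simp [hlT] at h
      · rfl
    · rintro rfl
      exact ⟨Or.inr rfl, hw'⟩
  have hout : ∀ y ∉ S \ {l} ∪ T, y ≠ l → y ∉ S ∪ T := by
    rintro y hy hyl (h | h)
    · exact hy (Or.inl ⟨h, hyl⟩)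
    · exact hy (Or.inr h)
  have hnot : ∀ y ∉ S \ {l} ∪ T, y ≠ l → l ∉ closedNbhd G y := by
    intro y hy hyl h
    rcases mem_closedNbhd.mp h with h | h
    · exact hyl h.symm
    · exact hy ((hw y).mp h.symm ▸ hw')
  refine ⟨fun v => ?_, fun u hu v hv huv heq => ?_⟩
  · by_cases hv : v ∈ S \ {l} ∪ T
    · exact ⟨v, mem_closedNbhd.mpr (Or.inl rfl), hv⟩
    by_cases hvl : v = l
    · rw [hvl, hl]
      exact Set.singleton_nonempty w
    obtain ⟨x, hx, hxS⟩ := hS.1 v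
    exact ⟨x, hx, Or.inl ⟨hxS, fun h => hnot v hv hvl (Set.mem_singleton_iff.mp h ▸ hx)⟩⟩
  · by_cases hul : u = l
    · exact hsep v (hout v hv (hul ▸ huv.symm)) (by rw [← heq, hul, hl])
    by_cases hvl : v = l
    · exact hsep u (hout u hu hul) (by rw [heq, hvl, hl])
    refine hS.2 u (fun h => hout u hu hul (Or.inl h)) v
      (fun h => hout v hv hvl (Or.inl h)) huv ?_
    ext x
    have hx := Set.ext_iff.mp heq x
    have hu' := hnot u hu hul
    have hv' := hnot v hv hvl
    by_cases hxl : x = l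
    · subst hxl
      simp [hu', hv']
    · simp only [Set.mem_inter_iff, Set.mem_union, Set.mem_sdiff, Set.mem_singleton_iff, hxl,
        not_false_eq_true, and_true] at hx ⊢
      tauto

/-- A leaf of a minimum locating-dominating set can be exchanged for a vertex that is not
a leaf. -/
theorem IsLDSet.exists_exchange_leaf {V : Type*} [Fintype V] {G : SimpleGraph V}
    (hn : 3 ≤ Fintype.card V) (hconn : G.Connected)
    (hot : ¬ ∃ u v : V, OpenTwins G u v ∧ deg G u = 1) {S : Set V} (hS : IsLDSet G S)
    (hcard : S.ncard = ldNum G) {l : V} (hlS : l ∈ S) (hl : deg G l = 1) :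
    ∃ a ∉ S, deg G a ≠ 1 ∧ IsLDSet G (S \ {l} ∪ {a}) := by
  obtain ⟨w, hw⟩ := exists_support_of_deg_eq_one hl
  have hlw : G.Adj l w := (hw w).mpr rfl
  by_cases hwS : w ∈ S
  · have hmin : ¬ IsLDSet G (S \ {l} ∪ ∅) := by
      intro h
      have h₁ := ldNum_le h
      have h₂ := Set.ncard_sdiff_singleton_lt_of_mem hlS
      rw [Set.union_empty] at h₁
      omega
    have hex : ∃ y ∉ S, closedNbhd G y ∩ (S \ {l}) = {w} := by
      by_contra! hne
      exact hmin (hS.sdiff_leaf_union hw (Set.notMem_empty l) (Or.inl hwS)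
        (by simpa using hne))
    have hnot : ∀ y ∉ S, closedNbhd G y ∩ (S \ {l}) = closedNbhd G y ∩ S := by
      intro y hy
      ext x
      simp only [Set.mem_inter_iff, Set.mem_sdiff, Set.mem_singleton_iff]
      refine ⟨fun h => ⟨h.1, h.2.1⟩, fun h => ⟨h.1, h.2, ?_⟩⟩
      rintro rfl
      rcases mem_closedNbhd.mp h.1 with h | h
      · exact hy (h ▸ hlS)
      · exact hy ((hw y).mp h.symm ▸ hwS)
    obtain ⟨y, hyS, hy⟩ := hex
    have hyw : G.Adj y w := by
      have : w ∈ closedNbhd G y := (hy.ge rfl).1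
      exact (mem_closedNbhd.mp this).resolve_left fun h => hyS (h ▸ hwS)
    have hly : l ≠ y := fun h => hyS (h ▸ hlS)
    refine ⟨y, hyS, fun hdeg => ?_, hS.sdiff_leaf_union hw hly (Or.inl hwS) ?_⟩
    · obtain ⟨w', hw'⟩ := exists_support_of_deg_eq_one hdeg
      obtain rfl := (hw' w).mp hyw
      refine hot ⟨l, y, ⟨hly, ?_⟩, hl⟩
      ext x
      simp only [mem_neighborSet, hw, hw']
    · intro v hv heq
      simp only [Set.mem_union, Set.mem_singleton_iff, not_or] at hv
      refine hS.2 v hv.1 y hyS hv.2 ?_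
      rw [← hnot v hv.1, ← hnot y hyS, hy]
      ext x
      have hx := Set.ext_iff.mp heq x
      simp only [Set.mem_inter_iff, Set.mem_union, Set.mem_singleton_iff] at hx ⊢
      constructor
      · exact fun h => hx.mp ⟨h.1, Or.inl h.2⟩
      · rintro rfl
        exact ⟨(hx.mpr rfl).1, hwS, hlw.ne'⟩
  · refine ⟨w, hwS, deg_support_ne_one hn hconn hw,
      hS.sdiff_leaf_union hw hlw.ne (Or.inr rfl) ?_⟩
    intro v hv heq
    simp only [Set.mem_union, Set.mem_singleton_iff, not_or] at hv
    obtain ⟨x, hx, hxS⟩ := hS.1 v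
    have hxl : x ≠ l := by
      rintro rfl
      rcases mem_closedNbhd.mp hx with h | h
      · exact hv.1 (h ▸ hxS)
      · exact hv.2 ((hw v).mp h.symm)
    have hxw : x = w := heq.le ⟨hx, Or.inl ⟨hxS, hxl⟩⟩
    exact hwS (hxw ▸ hxS)

/-- Every connected graph on at least three vertices without open twins
of degree 1 admits a minimum locating-dominating set containing no leaves. -/
theorem stmt6 {V : Type*} [Fintype V] (G : SimpleGraph V)
    (hn : 3 ≤ Fintype.card V) (hconn : G.Connected)
    (hot : ¬ ∃ u v : V, OpenTwins G u v ∧ deg G u = 1) :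
    ∃ S : Set V, IsLDSet G S ∧ S.ncard = ldNum G ∧
      ∀ v ∈ S, deg G v ≠ 1 := by
  let P : Set (Set V) := {S | IsLDSet G S ∧ S.ncard = ldNum G}
  obtain ⟨S, ⟨hS, hcard⟩, hmin⟩ := P.toFinite.exists_minimalFor
    (fun S => (S ∩ {v | deg G v = 1}).ncard) P (exists_isLDSet_ncard_eq_ldNum G)
  refine ⟨S, hS, hcard, fun l hlS hl => ?_⟩
  obtain ⟨a, haS, ha, hLD⟩ := hS.exists_exchange_leaf hn hconn hot hcard hlS hl
  have hcard' : (S \ {l} ∪ {a}).ncard = ldNum G := by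
    rw [Set.union_singleton, Set.ncard_exchange haS hlS, hcard]
  have hlt : ((S \ {l} ∪ {a}) ∩ {v | deg G v = 1}).ncard
      < (S ∩ {v | deg G v = 1}).ncard := by
    refine Set.ncard_lt_ncard ⟨?_, fun h => ?_⟩
    · rintro x ⟨hx | rfl, hx'⟩
      · exact ⟨hx.1, hx'⟩
      · exact absurd hx' ha
    · rcases (h ⟨hlS, hl⟩).1 with h | h
      · exact h.2 rfl
      · exact haS (Set.mem_singleton_iff.mp h ▸ hlS)
  exact absurd (hmin ⟨hLD, hcard'⟩ hlt.le) hlt.not_ge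
end

section
/- In a subcubic twin-free graph G, every 4-cycle is induced; that is, if v1, v2, v3, v4 form a 4-cycle with edges v1v2, v2v3, v3v4, v4v1, then the edges v1v3 and v2v4 are not present in G. -/
open SimpleGraph

theorem neighborSet_eq_of_deg_le_three {V : Type*} [Finite V] (G : SimpleGraph V)
    {v a b c : V} (hdeg : deg G v ≤ 3) (ha : G.Adj v a) (hb : G.Adj v b) (hc : G.Adj v c)
    (hab : a ≠ b) (hac : a ≠ c) (hbc : b ≠ c) : G.neighborSet v = {a, b, c} := by
  symm
  refine Set.eq_of_subset_of_ncard_le ?_ ?_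
  · rintro x (rfl | rfl | rfl) <;> assumption
  · rw [Set.ncard_eq_three.mpr ⟨a, b, c, hab, hac, hbc, rfl⟩]
    exact hdeg

theorem closedTwins_of_diagonal {V : Type*} [Finite V] (G : SimpleGraph V) (hsub : Subcubic G)
    {a b c d : V} (hab : G.Adj a b) (hbc : G.Adj b c) (hcd : G.Adj c d) (hda : G.Adj d a)
    (hbd : b ≠ d) (hac : G.Adj a c) : ClosedTwins G a c := by
  refine ⟨hac.ne, ?_⟩
  unfold closedNbhd
  rw [neighborSet_eq_of_deg_le_three G (hsub a) hac hab hda.symm hbc.ne' hcd.ne hbd,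
    neighborSet_eq_of_deg_le_three G (hsub c) hac.symm hbc.symm hcd hab.ne hda.ne' hbd,
    Set.insert_comm]

/-- In a subcubic twin-free graph every 4-cycle is induced: the diagonals
of any 4-cycle are non-edges. -/
theorem stmt9 {V : Type*} [Fintype V] (G : SimpleGraph V)
    (hsub : Subcubic G) (htf : TwinFree G)
    (v1 v2 v3 v4 : V)
    (h12 : G.Adj v1 v2) (h23 : G.Adj v2 v3) (h34 : G.Adj v3 v4) (h41 : G.Adj v4 v1)
    (h13 : v1 ≠ v3) (h24 : v2 ≠ v4) :
    ¬ G.Adj v1 v3 ∧ ¬ G.Adj v2 v4 := by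
  exact ⟨fun h => htf.2 ⟨v1, v3, closedTwins_of_diagonal G hsub h12 h23 h34 h41 h24 h⟩,
    fun h => htf.2 ⟨v2, v4, closedTwins_of_diagonal G hsub h23 h34 h41 h12 h13.symm h⟩⟩
end

section
/- For every positive integer k there exists a connected subcubic graph G on n = 12k vertices that contains a pair of open twins of degree 1 and satisfies γ^LD(G) = 7n/12; in particular γ^LD(G) > n/2. -/
open SimpleGraph

/-- The number `n` codes a vertex of the block `n / 4`: the residues `0, 1, 2, 3` modulo `4` are
the spine vertex, the centre adjacent to it, and the two leaves hanging from the centre.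
The relation lists the edges of the comb, each oriented upwards. -/
def CombEdge (u v : ℕ) : Prop :=
  (u % 4 = 0 ∧ (v = u + 1 ∨ v = u + 4)) ∨ (u % 4 = 1 ∧ (v = u + 1 ∨ v = u + 2))

/-- A path each of whose vertices is joined to the centre of a path on three vertices. -/
def comb (n : ℕ) : SimpleGraph (Fin n) where
  Adj u v := CombEdge u v ∨ CombEdge v u
  symm := ⟨fun _ _ h => h.symm⟩
  loopless := ⟨fun u h => by unfold CombEdge at h; omega⟩

/-- Membership in the closed neighbourhood of `v` in the comb. -/
def CombNear (v u : ℕ) : Prop :=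
  u = v ∨ CombEdge v u ∨ CombEdge u v

theorem mem_closedNbhd_comb {n : ℕ} (u v : Fin n) :
    u ∈ closedNbhd (comb n) v ↔ CombNear v u := by
  simp [closedNbhd, comb, CombNear, Fin.ext_iff]

theorem combNear_leaf {i r w : ℕ} (hr : r = 2 ∨ r = 3) :
    CombNear (4 * i + r) w ↔ w = 4 * i + r ∨ w = 4 * i + 1 := by
  unfold CombNear CombEdge
  rcases hr with rfl | rfl <;> omega

theorem combNear_spine {i w : ℕ} :
    CombNear (4 * (i + 1)) w ↔
      w = 4 * i ∨ w = 4 * (i + 1) ∨ w = 4 * (i + 2) ∨ w = 4 * (i + 1) + 1 := by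
  unfold CombNear CombEdge
  omega

theorem comb_connected {n : ℕ} (hn : 0 < n) : (comb n).Connected := by
  have reach : ∀ m, ∀ hm : m < n, (comb n).Reachable ⟨0, hn⟩ ⟨m, hm⟩ := by
    intro m
    induction m using Nat.strong_induction_on with
    | _ m ih =>
      intro hm
      rcases Nat.eq_zero_or_pos m with rfl | hpos
      · exact Reachable.refl _
      · obtain ⟨u, hu, hum⟩ : ∃ u < m, CombEdge u m := by
          unfold CombEdge
          by_cases h0 : m % 4 = 0
          · exact ⟨m - 4, by omega, by omega⟩
          · by_cases h3 : m % 4 = 3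
            · exact ⟨m - 2, by omega, by omega⟩
            · exact ⟨m - 1, by omega, by omega⟩
        have hadj : (comb n).Adj ⟨u, hu.trans hm⟩ ⟨m, hm⟩ := Or.inl hum
        exact (ih u hu _).trans hadj.reachable
  have : Nonempty (Fin n) := ⟨⟨0, hn⟩⟩
  exact ⟨fun u v => (reach u u.2).symm.trans (reach v v.2)⟩

theorem comb_subcubic (n : ℕ) : Subcubic (comb n) := by
  intro v
  obtain ⟨a, b, c, habc⟩ : ∃ a b c : ℕ, ∀ u : ℕ, CombEdge v u ∨ CombEdge u v →
      u = a ∨ u = b ∨ u = c := by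
    unfold CombEdge
    by_cases h0 : (v : ℕ) % 4 = 0
    · exact ⟨v - 4, v + 4, v + 1, by omega⟩
    · by_cases h1 : (v : ℕ) % 4 = 1
      · exact ⟨v - 1, v + 1, v + 2, by omega⟩
      · exact ⟨v - 1, v - 2, v - 2, by omega⟩
  have hsub : Fin.val '' (comb n).neighborSet v ⊆ (({a, b, c} : Finset ℕ) : Set ℕ) := by
    rintro _ ⟨u, hu, rfl⟩
    simpa using habc u hu
  calc deg (comb n) v = (Fin.val '' (comb n).neighborSet v).ncard :=
        (Set.ncard_image_of_injective _ Fin.val_injective).symm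
    _ ≤ (({a, b, c} : Finset ℕ) : Set ℕ).ncard := Set.ncard_le_ncard hsub (Finset.finite_toSet _)
    _ ≤ 3 := by rw [Set.ncard_coe_finset]; exact Finset.card_le_three

theorem comb_openTwins {n : ℕ} (hn : 4 ≤ n) :
    ∃ u v : Fin n, OpenTwins (comb n) u v ∧ deg (comb n) u = 1 := by
  have nbhd : ∀ u : Fin n, (u : ℕ) = 2 ∨ (u : ℕ) = 3 →
      (comb n).neighborSet u = {⟨1, by omega⟩} := by
    intro u hu
    ext w
    simp only [mem_neighborSet, comb, CombEdge, Set.mem_singleton_iff, Fin.ext_iff]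
    omega
  refine ⟨⟨2, by omega⟩, ⟨3, by omega⟩, ⟨by simp, ?_⟩, ?_⟩
  · rw [nbhd _ (Or.inl rfl), nbhd _ (Or.inr rfl)]
  · rw [deg, nbhd _ (Or.inl rfl), Set.ncard_singleton]

open Classical in
theorem ncard_eq_sum_range {n : ℕ} (S : Set (Fin n)) :
    S.ncard = ∑ i ∈ Finset.range n, if i ∈ Fin.val '' S then 1 else 0 := by
  rw [Finset.sum_range, Set.ncard_eq_toFinset_card']
  simp [Fin.val_inj]

theorem mul_le_sum_range_mul (f : ℕ → ℕ) (b c k : ℕ)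
    (h : ∀ t < k, c ≤ ∑ j ∈ Finset.range b, f (b * t + j)) :
    c * k ≤ ∑ i ∈ Finset.range (b * k), f i := by
  induction k with
  | zero => simp
  | succ k ih =>
    rw [Nat.mul_succ, Nat.mul_succ, Finset.sum_range_add]
    exact Nat.add_le_add (ih fun t ht => h t (by omega)) (h k (by omega))

theorem sum_range_mul_eq (f : ℕ → ℕ) (b c k : ℕ)
    (h : ∀ t < k, ∑ j ∈ Finset.range b, f (b * t + j) = c) :
    ∑ i ∈ Finset.range (b * k), f i = c * k := by
  induction k with
  | zero => simp
  | succ k ih =>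
    rw [Nat.mul_succ, Nat.mul_succ, Finset.sum_range_add,
      ih fun t ht => h t (by omega), h k (by omega)]

namespace IsLDSet

variable {n : ℕ} {S : Set (Fin n)}

theorem exists_combNear (hS : IsLDSet (comb n) S) {v : ℕ} (hv : v < n) :
    ∃ u ∈ Fin.val '' S, CombNear v u := by
  obtain ⟨u, huv, huS⟩ := hS.1 ⟨v, hv⟩
  exact ⟨u, ⟨u, huS, rfl⟩, (mem_closedNbhd_comb _ _).1 huv⟩

theorem exists_not_combNear_iff (hS : IsLDSet (comb n) S) {u v : ℕ} (hu : u < n) (hv : v < n)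
    (huS : u ∉ Fin.val '' S) (hvS : v ∉ Fin.val '' S) (huv : u ≠ v) :
    ∃ w ∈ Fin.val '' S, ¬ (CombNear u w ↔ CombNear v w) := by
  by_contra! H
  refine hS.2 ⟨u, hu⟩ (fun h => huS ⟨_, h, rfl⟩) ⟨v, hv⟩ (fun h => hvS ⟨_, h, rfl⟩)
    (by simpa using huv) ?_
  ext w
  simp only [Set.mem_inter_iff, mem_closedNbhd_comb]
  exact and_congr_left fun hw => H w ⟨w, hw, rfl⟩

/-- A leaf or its centre belongs to every locating-dominating set. -/
theorem leaf_or_centre (hS : IsLDSet (comb n) S) {i r : ℕ} (hr : r = 2 ∨ r = 3)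
    (hi : 4 * i + r < n) :
    4 * i + r ∈ Fin.val '' S ∨ 4 * i + 1 ∈ Fin.val '' S := by
  obtain ⟨u, huS, hu⟩ := hS.exists_combNear hi
  rcases (combNear_leaf hr).1 hu with rfl | rfl
  exacts [Or.inl huS, Or.inr huS]

/-- One of two leaves with a common centre belongs to every locating-dominating set. -/
theorem leaf_or_leaf (hS : IsLDSet (comb n) S) {i : ℕ} (hi : 4 * i + 3 < n) :
    4 * i + 2 ∈ Fin.val '' S ∨ 4 * i + 3 ∈ Fin.val '' S := by
  by_contra! H
  obtain ⟨w, hwS, hw⟩ :=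
    hS.exists_not_combNear_iff (by omega) hi H.1 H.2 (by omega)
  have h2 : w ≠ 4 * i + 2 := fun h => H.1 (h ▸ hwS)
  have h3 : w ≠ 4 * i + 3 := fun h => H.2 (h ▸ hwS)
  rw [combNear_leaf (Or.inl rfl), combNear_leaf (Or.inr rfl)] at hw
  tauto

/-- A locating-dominating set which misses a spine vertex and its spine neighbours contains the
whole three-vertex path attached to that spine vertex. -/
theorem of_spine_notMem (hS : IsLDSet (comb n) S) {i : ℕ} (hi : 4 * (i + 1) + 3 < n)
    (hprev : 4 * i ∉ Fin.val '' S) (hmid : 4 * (i + 1) ∉ Fin.val '' S)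
    (hnext : 4 * (i + 2) ∉ Fin.val '' S) :
    4 * (i + 1) + 1 ∈ Fin.val '' S ∧ 4 * (i + 1) + 2 ∈ Fin.val '' S ∧
      4 * (i + 1) + 3 ∈ Fin.val '' S := by
  have centre_only : ∀ w ∈ Fin.val '' S, CombNear (4 * (i + 1)) w → w = 4 * (i + 1) + 1 := by
    intro w hwS hw
    rcases combNear_spine.1 hw with rfl | rfl | rfl | rfl
    exacts [absurd hwS hprev, absurd hwS hmid, absurd hwS hnext, rfl]
  have leaf : ∀ r, r = 2 ∨ r = 3 → 4 * (i + 1) + r ∈ Fin.val '' S := by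
    intro r hr
    by_contra hleaf
    obtain ⟨w, hwS, hw⟩ :=
      hS.exists_not_combNear_iff (by omega) (by omega) hmid hleaf (by omega)
    have hne : w ≠ 4 * (i + 1) + r := fun h => hleaf (h ▸ hwS)
    have hcentre : CombNear (4 * (i + 1)) w ↔ w = 4 * (i + 1) + 1 :=
      ⟨centre_only w hwS, fun h => combNear_spine.2 (by tauto)⟩
    rw [hcentre, combNear_leaf hr] at hw
    tauto
  obtain ⟨u, huS, hu⟩ := hS.exists_combNear (show 4 * (i + 1) < n by omega)
  exact ⟨centre_only u huS hu ▸ huS, leaf 2 (Or.inl rfl), leaf 3 (Or.inr rfl)⟩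

theorem seven_mul_le_ncard {k : ℕ} {S : Set (Fin (12 * k))} (hS : IsLDSet (comb (12 * k)) S) :
    7 * k ≤ S.ncard := by
  classical
  rw [ncard_eq_sum_range]
  refine mul_le_sum_range_mul _ _ _ _ fun t ht => ?_
  set f : ℕ → ℕ := fun i => if i ∈ Fin.val '' S then 1 else 0 with hf
  change 7 ≤ ∑ j ∈ Finset.range 12, f (12 * t + j)
  have hpos : ∀ i, i ∈ Fin.val '' S ↔ f i = 1 := by intro i; simp [hf]
  have hle : ∀ i, f i ≤ 1 := by intro i; simp only [hf]; split_ifs <;> simp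
  have star : ∀ i < 3 * k, 2 ≤ f (4 * i + 1) + f (4 * i + 2) + f (4 * i + 3) := by
    intro i hi
    have h2 := hS.leaf_or_centre (i := i) (Or.inl rfl) (by omega)
    have h3 := hS.leaf_or_centre (i := i) (Or.inr rfl) (by omega)
    have h23 := hS.leaf_or_leaf (i := i) (by omega)
    rw [hpos, hpos] at h2 h3 h23
    omega
  have spine := hS.of_spine_notMem (i := 3 * t) (by omega)
  simp only [hpos] at spine
  have s0 := star (3 * t) (by omega)
  have s1 := star (3 * t + 1) (by omega)
  have s2 := star (3 * t + 2) (by omega)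
  have l0 := hle (4 * (3 * t))
  have l1 := hle (4 * (3 * t + 1))
  have l2 := hle (4 * (3 * t + 2))
  simp only [Finset.sum_range_succ, Finset.sum_range_zero]
  ring_nf at spine s0 s1 s2 l0 l1 l2 ⊢
  omega

end IsLDSet

/-- Each centre, one leaf at each centre, and every third spine vertex. -/
def combLDSet (n : ℕ) : Set (Fin n) :=
  {v | (v : ℕ) % 4 = 1 ∨ (v : ℕ) % 4 = 2 ∨ (v : ℕ) % 12 = 4}

theorem isLDSet_combLDSet (k : ℕ) : IsLDSet (comb (12 * k)) (combLDSet (12 * k)) := by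
  constructor
  · intro v
    obtain ⟨u, hu, hvu, huS⟩ : ∃ u < 12 * k, CombNear v u ∧
        (u % 4 = 1 ∨ u % 4 = 2 ∨ u % 12 = 4) := by
      unfold CombNear CombEdge
      by_cases h0 : (v : ℕ) % 4 = 0
      · exact ⟨v + 1, by omega, by omega⟩
      · by_cases h3 : (v : ℕ) % 4 = 3
        · exact ⟨v - 2, by omega, by omega⟩
        · exact ⟨v, by omega, by omega⟩
    exact ⟨⟨u, hu⟩, (mem_closedNbhd_comb _ _).2 hvu, huS⟩
  · intro u hu v hv huv heq
    have near : ∀ w < 12 * k, w % 4 = 1 ∨ w % 4 = 2 ∨ w % 12 = 4 →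
        (CombNear u w ↔ CombNear v w) := by
      intro w hw hwS
      have := Set.ext_iff.1 heq ⟨w, hw⟩
      simp only [Set.mem_inter_iff, mem_closedNbhd_comb] at this
      exact (and_congr_left_iff.1 this) hwS
    have huS : ¬ ((u : ℕ) % 4 = 1 ∨ (u : ℕ) % 4 = 2 ∨ (u : ℕ) % 12 = 4) := hu
    have hvS : ¬ ((v : ℕ) % 4 = 1 ∨ (v : ℕ) % 4 = 2 ∨ (v : ℕ) % 12 = 4) := hv
    have hlt := Fin.val_ne_of_ne huv
    clear heq hu hv huv
    wlog huv : (u : ℕ) < v generalizing u v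
    · exact this v u (fun w hw hwS => (near w hw hwS).symm) hvS huS hlt.symm (by omega)
    have block : (u : ℕ) / 4 = v / 4 := by
      have hc : CombNear v (4 * (u / 4) + 1) := by
        refine (near _ (by omega) (by omega)).1 ?_
        unfold CombNear CombEdge
        omega
      unfold CombNear CombEdge at hc
      omega
    obtain ⟨w, hw, hwS, huw⟩ : ∃ w < 12 * k, w % 12 = 4 ∧ CombNear u w := by
      refine ⟨12 * (u / 12) + 4, by omega, by omega, ?_⟩
      unfold CombNear CombEdge
      omega
    have hvw := (near w hw (by omega)).1 huw
    unfold CombNear CombEdge at hvw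
    omega

theorem ncard_combLDSet (k : ℕ) : (combLDSet (12 * k)).ncard = 7 * k := by
  classical
  rw [ncard_eq_sum_range, ← sum_range_mul_eq
    (fun i => if i % 4 = 1 ∨ i % 4 = 2 ∨ i % 12 = 4 then 1 else 0) 12 7 k]
  · refine Finset.sum_congr rfl fun i hi => if_congr ?_ rfl rfl
    constructor
    · rintro ⟨v, hv, rfl⟩
      exact hv
    · exact fun h => ⟨⟨i, Finset.mem_range.1 hi⟩, h, rfl⟩
  · intro t _
    have h4 : ∀ j, (12 * t + j) % 4 = j % 4 := by omega
    have h12 : ∀ j, (12 * t + j) % 12 = j % 12 := by omega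
    simp only [h4, h12]
    decide

theorem ldNum_comb (k : ℕ) : ldNum (comb (12 * k)) = 7 * k := by
  refine le_antisymm (Nat.sInf_le ⟨_, isLDSet_combLDSet k, ncard_combLDSet k⟩) ?_
  refine le_csInf ⟨_, _, isLDSet_combLDSet k, rfl⟩ ?_
  rintro _ ⟨S, hS, rfl⟩
  exact hS.seven_mul_le_ncard

/-- For every positive `k` there is a connected subcubic graph on
`n = 12k` vertices with a pair of open twins of degree 1 whose location-domination
number equals `7n/12 = 7k`; in particular it exceeds `n/2`. -/
theorem stmt10 (k : ℕ) (hk : 0 < k) :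
    ∃ G : SimpleGraph (Fin (12 * k)), G.Connected ∧ Subcubic G ∧
      (∃ u v : Fin (12 * k), OpenTwins G u v ∧ deg G u = 1) ∧
      ldNum G = 7 * k ∧ 2 * ldNum G > 12 * k := by
  have hld := ldNum_comb k
  exact ⟨comb (12 * k), comb_connected (by omega), comb_subcubic _, comb_openTwins (by omega),
    hld, by omega⟩
end

section
/- For every positive integer k there exists a connected subcubic graph G on n = 60k vertices that contains a pair of open twins of degree 2 and satisfies γ^LD(G) ≥ 8n/15; in particular γ^LD(G) > n/2. -/
open SimpleGraph

/-- The edges `{i, j}`, `i < j`, of the extremal graph. The vertices are grouped into units of five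
consecutive numbers whose first vertices form a path. Hanging from the first vertex `c` of a unit is
either a path `c, c + 1, c + 2` with two leaves `c + 3`, `c + 4` at its end, or, in every third
unit, the 4-cycle `c + 1, c + 2, c + 4, c + 3`. -/
def UnitEdge (i j : ℕ) : Prop :=
  (i % 5 = 0 ∧ j = i + 5) ∨ (i % 5 = 0 ∧ j = i + 1) ∨ (i % 5 = 1 ∧ j = i + 1) ∨
    (i % 5 = 2 ∧ j = i + 2) ∨ (i % 15 = 2 ∧ j = i + 1) ∨ (i % 15 = 7 ∧ j = i + 1) ∨
    (i % 15 = 11 ∧ j = i + 2) ∨ (i % 15 = 13 ∧ j = i + 1)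

theorem unitEdge_leaf_unit_one_iff {c l : ℕ} (hc : c % 15 = 0 ∨ c % 15 = 5) :
    UnitEdge (c + 1) l ∨ UnitEdge l (c + 1) ↔ l = c ∨ l = c + 2 := by
  unfold UnitEdge
  refine ⟨fun h => by omega, ?_⟩
  rintro (rfl | rfl)
  · exact .inr <| .inr <| .inl ⟨by omega, rfl⟩
  · exact .inl <| .inr <| .inr <| .inl ⟨by omega, rfl⟩

theorem unitEdge_leaf_unit_three_iff {c l : ℕ} (hc : c % 15 = 0 ∨ c % 15 = 5) :
    UnitEdge (c + 3) l ∨ UnitEdge l (c + 3) ↔ l = c + 2 := by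
  unfold UnitEdge
  refine ⟨fun h => by omega, ?_⟩
  rintro rfl
  rcases hc with hc | hc
  · exact .inr <| .inr <| .inr <| .inr <| .inr <| .inl ⟨by omega, rfl⟩
  · exact .inr <| .inr <| .inr <| .inr <| .inr <| .inr <| .inl ⟨by omega, rfl⟩

theorem unitEdge_leaf_unit_four_iff {c l : ℕ} (hc : c % 15 = 0 ∨ c % 15 = 5) :
    UnitEdge (c + 4) l ∨ UnitEdge l (c + 4) ↔ l = c + 2 := by
  unfold UnitEdge
  refine ⟨fun h => by omega, ?_⟩
  rintro rfl
  exact .inr <| .inr <| .inr <| .inr <| .inl ⟨by omega, rfl⟩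

theorem unitEdge_cycle_unit_two_iff {c l : ℕ} (hc : c % 15 = 10) :
    UnitEdge (c + 2) l ∨ UnitEdge l (c + 2) ↔ l = c + 1 ∨ l = c + 4 := by
  unfold UnitEdge
  refine ⟨fun h => by omega, ?_⟩
  rintro (rfl | rfl)
  · exact .inr <| .inr <| .inr <| .inl ⟨by omega, rfl⟩
  · exact .inl <| .inr <| .inr <| .inr <| .inl ⟨by omega, rfl⟩

theorem unitEdge_cycle_unit_three_iff {c l : ℕ} (hc : c % 15 = 10) :
    UnitEdge (c + 3) l ∨ UnitEdge l (c + 3) ↔ l = c + 1 ∨ l = c + 4 := by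
  unfold UnitEdge
  refine ⟨fun h => by omega, ?_⟩
  rintro (rfl | rfl)
  · exact .inr <| .inr <| .inr <| .inr <| .inr <| .inr <| .inr <| .inl ⟨by omega, rfl⟩
  · exact .inl <| .inr <| .inr <| .inr <| .inr <| .inr <| .inr <| .inr ⟨by omega, rfl⟩

/-- The extremal graph, truncated to its first `n` vertices. -/
def unitGraph (n : ℕ) : SimpleGraph (Fin n) where
  Adj u v := UnitEdge u v ∨ UnitEdge v u
  symm := ⟨fun _ _ h => h.symm⟩
  loopless := ⟨fun v h => by simp only [UnitEdge] at h; omega⟩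

theorem unitGraph_adj {n : ℕ} {u v : Fin n} :
    (unitGraph n).Adj u v ↔ UnitEdge u v ∨ UnitEdge v u := Iff.rfl

theorem unitGraph_connected {n : ℕ} (hn : 0 < n) : (unitGraph n).Connected := by
  have key : ∀ i (hi : i < n), (unitGraph n).Reachable ⟨i, hi⟩ ⟨0, hn⟩ := by
    intro i
    induction i using Nat.strong_induction_on with
    | _ i ih =>
      intro hi
      rcases Nat.eq_zero_or_pos i with rfl | hpos
      · exact Reachable.refl _
      obtain ⟨j, hj, hji⟩ : ∃ j, j < i ∧ UnitEdge j i := by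
        unfold UnitEdge
        have h5 : i % 5 = 0 ∨ i % 5 = 1 ∨ i % 5 = 2 ∨ i % 5 = 4 ∨
            (i % 5 = 3 ∧ i % 15 = 13) ∨ (i % 5 = 3 ∧ i % 15 ≠ 13) := by omega
        rcases h5 with h | h | h | h | h | h
        · exact ⟨i - 5, by omega, by omega⟩
        · exact ⟨i - 1, by omega, by omega⟩
        · exact ⟨i - 1, by omega, by omega⟩
        · exact ⟨i - 2, by omega, by omega⟩
        · exact ⟨i - 2, by omega, by omega⟩
        · exact ⟨i - 1, by omega, by omega⟩
      have hadj : (unitGraph n).Adj ⟨i, hi⟩ ⟨j, hj.trans hi⟩ := unitGraph_adj.2 (Or.inr hji)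
      exact hadj.reachable.trans (ih j hj _)
  have : Nonempty (Fin n) := ⟨⟨0, hn⟩⟩
  exact Connected.mk fun u v => (key u u.2).trans (key v v.2).symm

theorem deg_le_three_of_forall_adj {n : ℕ} {G : SimpleGraph (Fin n)} {v : Fin n} (a b c : ℕ)
    (h : ∀ w, G.Adj v w → (w : ℕ) = a ∨ (w : ℕ) = b ∨ (w : ℕ) = c) : deg G v ≤ 3 := by
  rw [deg, ← Set.ncard_image_of_injective _ Fin.val_injective]
  have hsub : Fin.val '' G.neighborSet v ⊆ (({a, b, c} : Finset ℕ) : Set ℕ) := by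
    rintro _ ⟨w, hw, rfl⟩
    simpa using h w hw
  exact (Set.ncard_le_ncard hsub (Finset.finite_toSet _)).trans
    ((Set.ncard_coe_finset _).trans_le Finset.card_le_three)

theorem unitGraph_subcubic (n : ℕ) : Subcubic (unitGraph n) := by
  intro v
  have h5 : (v : ℕ) % 5 = 0 ∨ (v : ℕ) % 5 = 3 ∨ (v : ℕ) % 5 = 4 ∨
      ((v : ℕ) % 5 = 2 ∧ (v : ℕ) % 15 ≠ 12) ∨ (v : ℕ) % 15 = 12 ∨
      ((v : ℕ) % 5 = 1 ∧ (v : ℕ) % 15 ≠ 11) ∨ (v : ℕ) % 15 = 11 := by omega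
  rcases h5 with h | h | h | h | h | h | h
  · apply deg_le_three_of_forall_adj (v - 5) (v + 1) (v + 5)
    intro w hw
    simp only [unitGraph_adj, UnitEdge] at hw
    omega
  · apply deg_le_three_of_forall_adj (v - 2) (v - 1) (v + 1)
    intro w hw
    simp only [unitGraph_adj, UnitEdge] at hw
    omega
  · apply deg_le_three_of_forall_adj (v - 2) (v - 1) (v - 1)
    intro w hw
    simp only [unitGraph_adj, UnitEdge] at hw
    omega
  · apply deg_le_three_of_forall_adj (v - 1) (v + 1) (v + 2)
    intro w hw
    simp only [unitGraph_adj, UnitEdge] at hw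
    omega
  · apply deg_le_three_of_forall_adj (v - 1) (v + 2) (v + 2)
    intro w hw
    simp only [unitGraph_adj, UnitEdge] at hw
    omega
  · apply deg_le_three_of_forall_adj (v - 1) (v + 1) (v + 1)
    intro w hw
    simp only [unitGraph_adj, UnitEdge] at hw
    omega
  · apply deg_le_three_of_forall_adj (v - 1) (v + 1) (v + 2)
    intro w hw
    simp only [unitGraph_adj, UnitEdge] at hw
    omega

theorem unitGraph_exists_openTwins {n : ℕ} (hn : 15 ≤ n) :
    ∃ u v : Fin n, OpenTwins (unitGraph n) u v ∧ deg (unitGraph n) u = 2 := by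
  have hu : (unitGraph n).neighborSet ⟨12, by omega⟩ = {⟨11, by omega⟩, ⟨14, by omega⟩} := by
    ext w
    simp only [mem_neighborSet, unitGraph_adj, Set.mem_insert_iff, Set.mem_singleton_iff,
      Fin.ext_iff]
    exact unitEdge_cycle_unit_two_iff (c := 10) rfl
  have hv : (unitGraph n).neighborSet ⟨13, by omega⟩ = {⟨11, by omega⟩, ⟨14, by omega⟩} := by
    ext w
    simp only [mem_neighborSet, unitGraph_adj, Set.mem_insert_iff, Set.mem_singleton_iff,
      Fin.ext_iff]
    exact unitEdge_cycle_unit_three_iff (c := 10) rfl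
  refine ⟨⟨12, by omega⟩, ⟨13, by omega⟩, ⟨by simp, hu.trans hv.symm⟩, ?_⟩
  rw [deg, hu]
  exact Set.ncard_pair (by simp)

theorem isLDSet_univ {V : Type*} (G : SimpleGraph V) : IsLDSet G Set.univ :=
  ⟨fun v => ⟨v, Set.mem_insert _ _, trivial⟩, fun _ hu => (hu trivial).elim⟩

theorem IsLDSet.exists_adj {V : Type*} {G : SimpleGraph V} {S : Set V} (h : IsLDSet G S)
    {v : V} (hv : v ∉ S) : ∃ w ∈ S, G.Adj v w := by
  obtain ⟨w, hw, hwS⟩ := h.1 v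
  rcases hw with rfl | hw
  · exact (hv hwS).elim
  · exact ⟨w, hwS, hw⟩

theorem IsLDSet.exists_separating {V : Type*} {G : SimpleGraph V} {S : Set V} (h : IsLDSet G S)
    {u v : V} (hu : u ∉ S) (hv : v ∉ S) (huv : u ≠ v) :
    ∃ w ∈ S, ¬ (G.Adj u w ↔ G.Adj v w) := by
  by_contra! hcon
  refine h.2 u hu v hv huv (Set.ext fun w => and_congr_left fun hw => ?_)
  have hwu : w ≠ u := fun e => hu (e ▸ hw)
  have hwv : w ≠ v := fun e => hv (e ▸ hw)
  simpa [closedNbhd, hwu, hwv] using hcon w hw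

theorem unitGraph_exists_unitEdge {n : ℕ} {S : Set (Fin n)} (h : IsLDSet (unitGraph n) S) {i : ℕ}
    (hi : i < n) (hiS : i ∉ Fin.val '' S) :
    ∃ j ∈ Fin.val '' S, UnitEdge i j ∨ UnitEdge j i := by
  obtain ⟨w, hw, hadj⟩ := h.exists_adj (v := ⟨i, hi⟩) fun hS => hiS ⟨_, hS, rfl⟩
  exact ⟨w, ⟨w, hw, rfl⟩, hadj⟩

theorem unitGraph_exists_separating {n : ℕ} {S : Set (Fin n)} (h : IsLDSet (unitGraph n) S)
    {i j : ℕ} (hi : i < n) (hj : j < n) (hij : i ≠ j) (hiS : i ∉ Fin.val '' S)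
    (hjS : j ∉ Fin.val '' S) :
    ∃ l ∈ Fin.val '' S, ¬ ((UnitEdge i l ∨ UnitEdge l i) ↔ (UnitEdge j l ∨ UnitEdge l j)) := by
  obtain ⟨w, hw, hsep⟩ := h.exists_separating (u := ⟨i, hi⟩) (v := ⟨j, hj⟩)
    (fun hS => hiS ⟨_, hS, rfl⟩) (fun hS => hjS ⟨_, hS, rfl⟩) (by simpa using hij)
  exact ⟨w, ⟨w, hw, rfl⟩, hsep⟩

theorem eight_mul_le_sum_range {f : ℕ → ℕ} {m : ℕ}
    (h : ∀ q < m, 8 ≤ ∑ r ∈ Finset.range 15, f (15 * q + r)) :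
    8 * m ≤ ∑ i ∈ Finset.range (15 * m), f i := by
  induction m with
  | zero => simp
  | succ m ih =>
    rw [Nat.mul_succ, Nat.mul_succ, Finset.sum_range_add]
    exact Nat.add_le_add (ih fun q hq => h q (by omega)) (h m (by omega))

open Classical in
/-- A locating-dominating set meets every unit ending in two leaves in at least three vertices. -/
theorem three_le_of_leaf_unit {n : ℕ} {S : Set (Fin n)} (h : IsLDSet (unitGraph n) S) {c : ℕ}
    (hc : c % 15 = 0 ∨ c % 15 = 5) (hcn : c + 4 < n) :
    3 ≤ ∑ r ∈ Finset.range 5, if c + r ∈ Fin.val '' S then 1 else 0 := by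
  have dom3 : c + 3 ∉ Fin.val '' S → c + 2 ∈ Fin.val '' S := fun h3 => by
    simpa [unitEdge_leaf_unit_three_iff hc] using unitGraph_exists_unitEdge h (by omega) h3
  have dom4 : c + 4 ∉ Fin.val '' S → c + 2 ∈ Fin.val '' S := fun h4 => by
    simpa [unitEdge_leaf_unit_four_iff hc] using unitGraph_exists_unitEdge h (by omega) h4
  have dom1 : c + 1 ∉ Fin.val '' S → c ∈ Fin.val '' S ∨ c + 2 ∈ Fin.val '' S := fun h1 => by
    obtain ⟨j, hj, hadj⟩ := unitGraph_exists_unitEdge h (by omega) h1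
    rcases (unitEdge_leaf_unit_one_iff hc).1 hadj with rfl | rfl <;> simp [hj]
  have sep34 : c + 3 ∈ Fin.val '' S ∨ c + 4 ∈ Fin.val '' S := by
    by_contra! hcon
    obtain ⟨l, -, hsep⟩ :=
      unitGraph_exists_separating h (by omega) (by omega) (by omega) hcon.1 hcon.2
    rw [unitEdge_leaf_unit_three_iff hc, unitEdge_leaf_unit_four_iff hc] at hsep
    exact hsep Iff.rfl
  have sep13 : c + 1 ∉ Fin.val '' S → c + 3 ∉ Fin.val '' S → c ∈ Fin.val '' S := fun h1 h3 => by
    obtain ⟨l, hl, hsep⟩ := unitGraph_exists_separating h (by omega) (by omega) (by omega) h1 h3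
    rw [unitEdge_leaf_unit_one_iff hc, unitEdge_leaf_unit_three_iff hc] at hsep
    have : l = c := by omega
    exact this ▸ hl
  have sep14 : c + 1 ∉ Fin.val '' S → c + 4 ∉ Fin.val '' S → c ∈ Fin.val '' S := fun h1 h4 => by
    obtain ⟨l, hl, hsep⟩ := unitGraph_exists_separating h (by omega) (by omega) (by omega) h1 h4
    rw [unitEdge_leaf_unit_one_iff hc, unitEdge_leaf_unit_four_iff hc] at hsep
    have : l = c := by omega
    exact this ▸ hl
  simp only [Finset.sum_range_succ, Finset.sum_range_zero, add_zero, zero_add]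
  clear h hc hcn
  generalize Fin.val '' S = T at *
  split_ifs <;> simp_all

open Classical in
/-- A locating-dominating set meets every unit containing a 4-cycle in at least two vertices. -/
theorem two_le_of_cycle_unit {n : ℕ} {S : Set (Fin n)} (h : IsLDSet (unitGraph n) S) {c : ℕ}
    (hc : c % 15 = 10) (hcn : c + 4 < n) :
    2 ≤ ∑ r ∈ Finset.range 5, if c + r ∈ Fin.val '' S then 1 else 0 := by
  have dom2 : c + 2 ∉ Fin.val '' S → c + 1 ∈ Fin.val '' S ∨ c + 4 ∈ Fin.val '' S := fun h2 => by
    obtain ⟨j, hj, hadj⟩ := unitGraph_exists_unitEdge h (by omega) h2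
    rcases (unitEdge_cycle_unit_two_iff hc).1 hadj with rfl | rfl <;> simp [hj]
  have dom3 : c + 3 ∉ Fin.val '' S → c + 1 ∈ Fin.val '' S ∨ c + 4 ∈ Fin.val '' S := fun h3 => by
    obtain ⟨j, hj, hadj⟩ := unitGraph_exists_unitEdge h (by omega) h3
    rcases (unitEdge_cycle_unit_three_iff hc).1 hadj with rfl | rfl <;> simp [hj]
  have sep23 : c + 2 ∈ Fin.val '' S ∨ c + 3 ∈ Fin.val '' S := by
    by_contra! hcon
    obtain ⟨l, -, hsep⟩ :=
      unitGraph_exists_separating h (by omega) (by omega) (by omega) hcon.1 hcon.2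
    rw [unitEdge_cycle_unit_two_iff hc, unitEdge_cycle_unit_three_iff hc] at hsep
    exact hsep Iff.rfl
  simp only [Finset.sum_range_succ, Finset.sum_range_zero, add_zero, zero_add]
  clear h hc hcn
  generalize Fin.val '' S = T at *
  split_ifs <;> simp_all

theorem eight_mul_le_ncard {m : ℕ} {S : Set (Fin (15 * m))}
    (h : IsLDSet (unitGraph (15 * m)) S) : 8 * m ≤ S.ncard := by
  classical
  rw [ncard_eq_sum_range]
  refine eight_mul_le_sum_range fun q hq => ?_
  have h0 := three_le_of_leaf_unit h (c := 15 * q) (by omega) (by omega)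
  have h1 := three_le_of_leaf_unit h (c := 15 * q + 5) (by omega) (by omega)
  have h2 := two_le_of_cycle_unit h (c := 15 * q + 10) (by omega) (by omega)
  rw [show Finset.range 15 = Finset.range (5 + 5 + 5) from rfl, Finset.sum_range_add,
    Finset.sum_range_add]
  simp only [add_assoc] at h0 h1 h2 ⊢
  exact Nat.add_le_add h0 (Nat.add_le_add h1 h2)

/-- For every positive `k` there is a connected subcubic graph on
`n = 60k` vertices with a pair of open twins of degree 2 whose location-domination
number is at least `8n/15 = 32k`; in particular it exceeds `n/2`. -/
theorem stmt11 (k : ℕ) (hk : 0 < k) :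
    ∃ G : SimpleGraph (Fin (60 * k)), G.Connected ∧ Subcubic G ∧
      (∃ u v : Fin (60 * k), OpenTwins G u v ∧ deg G u = 2) ∧
      32 * k ≤ ldNum G ∧ 2 * ldNum G > 60 * k := by
  have hbound : 32 * k ≤ ldNum (unitGraph (60 * k)) := by
    obtain ⟨S, hS, hcard⟩ := exists_isLDSet_ncard_eq_ldNum (unitGraph (60 * k))
    rw [← hcard]
    have key : ∀ n, n = 15 * (4 * k) → ∀ S : Set (Fin n), IsLDSet (unitGraph n) S →
        8 * (4 * k) ≤ S.ncard := by
      rintro _ rfl S hS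
      exact eight_mul_le_ncard hS
    have := key _ (by omega) S hS
    omega
  exact ⟨unitGraph (60 * k), unitGraph_connected (by omega), unitGraph_subcubic _,
    unitGraph_exists_openTwins (by omega), hbound, by omega⟩
end

section
/- For every integer r ≥ 4 and every positive integer k, there exists a connected r-regular graph G on n = (3r+3)k vertices that contains closed twins and satisfies γ^LD(G) = (3r−4)n/(3r+3); in particular γ^LD(G) > n/2. -/
open SimpleGraph

namespace SimpleGraph

section Transport

variable {V W : Type*} {G : SimpleGraph V} {H : SimpleGraph W}

lemma Iso.image_closedNbhd (e : G ≃g H) (v : V) :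
    e '' closedNbhd G v = closedNbhd H (e v) := by
  rw [closedNbhd, Set.image_insert_eq, e.image_neighborSet, closedNbhd]

lemma Iso.deg_eq (e : G ≃g H) (v : V) : deg H (e v) = deg G v := by
  rw [deg, deg, ← e.image_neighborSet, Set.ncard_image_of_injective _ e.injective]

lemma Iso.closedTwins (e : G ≃g H) {u v : V} (h : ClosedTwins G u v) :
    ClosedTwins H (e u) (e v) :=
  ⟨e.injective.ne h.1, by rw [← e.image_closedNbhd, ← e.image_closedNbhd, h.2]⟩

lemma Iso.isLDSet_image (e : G ≃g H) {S : Set V} (h : IsLDSet G S) : IsLDSet H (e '' S) := by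
  have key (v : V) : closedNbhd H (e v) ∩ e '' S = e '' (closedNbhd G v ∩ S) := by
    rw [Set.image_inter e.injective, e.image_closedNbhd]
  refine ⟨fun w => ?_, fun u hu v hv huv => ?_⟩
  · obtain ⟨v, rfl⟩ := e.surjective w
    rw [key]
    exact (h.1 v).image e
  · obtain ⟨u, rfl⟩ := e.surjective u
    obtain ⟨v, rfl⟩ := e.surjective v
    rw [key, key, e.injective.image_injective.ne_iff]
    rw [e.injective.mem_set_image] at hu hv
    exact h.2 u hu v hv fun h => huv (h ▸ rfl)

lemma Iso.ldNum_eq (e : G ≃g H) : ldNum H = ldNum G := by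
  refine congrArg sInf (Set.ext fun n => ⟨?_, ?_⟩)
  · rintro ⟨S, hS, rfl⟩
    exact ⟨_, e.symm.isLDSet_image hS, Set.ncard_image_of_injective _ e.symm.injective⟩
  · rintro ⟨S, hS, rfl⟩
    exact ⟨_, e.isLDSet_image hS, Set.ncard_image_of_injective _ e.injective⟩

end Transport

/-- The displacement in the ring of cliques along the outer edge of a port. -/
def portShift (m : ℕ) : Bool → ZMod m
  | true => 1
  | false => -1

lemma portShift_not (m : ℕ) (a : Bool) : portShift m (!a) = -portShift m a := by
  cases a <;> simp [portShift]

/-- A cyclic arrangement of `m` copies of the complete graph on `s + 2` vertices, each with one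
edge removed: the ends of that edge (the ports `(i, Sum.inl a)`) are joined instead to the
neighbouring copies. -/
def cliqueRing (m s : ℕ) : SimpleGraph (ZMod m × (Bool ⊕ Fin s)) where
  Adj
    | (i, .inl a), (j, .inl b) => b = !a ∧ j = i + portShift m a
    | (i, .inl _), (j, .inr _) => i = j
    | (i, .inr _), (j, .inl _) => i = j
    | (i, .inr c), (j, .inr d) => i = j ∧ c ≠ d
  symm := ⟨by
    rintro ⟨i, a | c⟩ ⟨j, b | d⟩ h
    · obtain ⟨rfl, rfl⟩ := h
      simp [portShift_not]
    · exact h.symm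
    · exact h.symm
    · exact ⟨h.1.symm, h.2.symm⟩⟩
  loopless := ⟨by
    rintro ⟨i, a | c⟩ h
    · simpa using h.1
    · exact h.2 rfl⟩

variable {m s : ℕ}

@[simp]
lemma cliqueRing_adj_inl_inl {i j : ZMod m} {a b : Bool} :
    (cliqueRing m s).Adj (i, .inl a) (j, .inl b) ↔ b = !a ∧ j = i + portShift m a := Iff.rfl

@[simp]
lemma cliqueRing_adj_inl_inr {i j : ZMod m} {a : Bool} {d : Fin s} :
    (cliqueRing m s).Adj (i, .inl a) (j, .inr d) ↔ i = j := Iff.rfl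

@[simp]
lemma cliqueRing_adj_inr_inl {i j : ZMod m} {c : Fin s} {b : Bool} :
    (cliqueRing m s).Adj (i, .inr c) (j, .inl b) ↔ i = j := Iff.rfl

@[simp]
lemma cliqueRing_adj_inr_inr {i j : ZMod m} {c d : Fin s} :
    (cliqueRing m s).Adj (i, .inr c) (j, .inr d) ↔ i = j ∧ c ≠ d := Iff.rfl

lemma closedNbhd_cliqueRing_inr (i : ZMod m) (c : Fin s) :
    closedNbhd (cliqueRing m s) (i, .inr c) = Set.range (Prod.mk i) := by
  ext ⟨j, b | d⟩
  · simp [closedNbhd]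
  · simp only [closedNbhd, Set.mem_insert_iff, Prod.mk.injEq, Sum.inr.injEq, mem_neighborSet,
      cliqueRing_adj_inr_inr, Set.mem_range]
    grind

lemma neighborSet_cliqueRing_inl (i : ZMod m) (a : Bool) :
    (cliqueRing m s).neighborSet (i, .inl a) =
      insert (i + portShift m a, .inl !a) (Set.range fun c => (i, .inr c)) := by
  ext ⟨j, b | d⟩
  · simp [and_comm]
  · simp

lemma closedTwins_cliqueRing (i : ZMod m) {c d : Fin s} (h : c ≠ d) :
    ClosedTwins (cliqueRing m s) (i, .inr c) (i, .inr d) :=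
  ⟨by simpa using h, by simp only [closedNbhd_cliqueRing_inr]⟩

lemma deg_cliqueRing (v : ZMod m × (Bool ⊕ Fin s)) : deg (cliqueRing m s) v = s + 1 := by
  obtain ⟨i, a | c⟩ := v
  · rw [deg, neighborSet_cliqueRing_inl, Set.ncard_insert_of_notMem (by simp) (Set.finite_range _),
      Set.ncard_range_of_injective (fun c d h => by simpa using h), Nat.card_fin]
  · have h := congrArg Set.ncard (closedNbhd_cliqueRing_inr i c)
    rw [Set.ncard_range_of_injective (Prod.mk_right_injective i), closedNbhd,
      Set.ncard_insert_of_notMem (by simp)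
        ((Set.finite_range (Prod.mk i)).subset fun w hw => by
          rw [← closedNbhd_cliqueRing_inr i c]; exact Or.inr hw)] at h
    simp only [Nat.card_eq_fintype_card, Fintype.card_sum, Fintype.card_bool,
      Fintype.card_fin] at h
    rw [deg]
    omega

lemma connected_cliqueRing [NeZero m] [NeZero s] : (cliqueRing m s).Connected := by
  have h (n : ℕ) :
      (cliqueRing m s).Reachable ((0 : ZMod m), .inr 0) ((n : ZMod m), .inr 0) := by
    induction n with
    | zero => rw [Nat.cast_zero]
    | succ n ih =>
      refine ih.trans ?_
      have h₁ : (cliqueRing m s).Adj ((n : ZMod m), .inr 0) (n, .inl true) := by simp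
      have h₂ : (cliqueRing m s).Adj ((n : ZMod m), .inl true) ((n + 1 : ℕ), .inl false) := by
        simp [portShift]
      have h₃ : (cliqueRing m s).Adj (((n + 1 : ℕ) : ZMod m), .inl false) ((n + 1 : ℕ), .inr 0) := by
        simp
      exact h₁.reachable.trans (h₂.reachable.trans h₃.reachable)
  refine connected_iff_exists_forall_reachable _ |>.2 ⟨(0, .inr 0), fun ⟨i, a⟩ => ?_⟩
  have hi := h i.val
  rw [ZMod.natCast_zmod_val] at hi
  refine hi.trans ?_
  obtain rfl | ha := eq_or_ne a (.inr 0)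
  · rfl
  · refine Adj.reachable ?_
    cases a with
    | inl a => simp
    | inr c => simpa [eq_comm] using ha

open scoped Classical in
/-- The number of vertices of the `i`-th clique that lie outside `S`. -/
noncomputable def missed (S : Set (ZMod m × (Bool ⊕ Fin s))) (i : ZMod m) : ℕ :=
  (if (i, .inl true) ∈ S then 0 else 1) + (if (i, .inl false) ∈ S then 0 else 1) +
    {c | (i, .inr c) ∉ S}.ncard

lemma ncard_add_sum_missed [NeZero m] (S : Set (ZMod m × (Bool ⊕ Fin s))) :
    S.ncard + ∑ i, missed S i = m * (s + 2) := by
  classical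
  have h : Sᶜ.ncard = ∑ i, missed S i := by
    rw [Set.compl_def, Set.ncard_eq_toFinset_card', Set.toFinset_ofPred, Finset.card_filter,
      Fintype.sum_prod_type]
    refine Finset.sum_congr rfl fun i _ => ?_
    rw [Fintype.sum_sum_type, missed, Set.ncard_eq_toFinset_card', Set.toFinset_ofPred,
      Finset.card_filter]
    simp [ite_not]
  rw [← h, Set.ncard_add_ncard_compl, Nat.card_eq_fintype_card]
  simp [ZMod.card, add_comm]

lemma sum_consecutive_triples [NeZero m] (f : ZMod m → ℕ) :
    ∑ i, (f i + f (i + 1) + f (i + 2)) = 3 * ∑ i, f i := by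
  have h (j : ZMod m) : ∑ i, f (i + j) = ∑ i, f i := Equiv.sum_comp (Equiv.addRight j) f
  rw [Finset.sum_add_distrib, Finset.sum_add_distrib, h, h]
  ring

section LowerBound

variable {S : Set (ZMod m × (Bool ⊕ Fin s))}

lemma IsLDSet.ncard_inr_notMem_le_one (hS : IsLDSet (cliqueRing m s) S) (i : ZMod m) :
    {c | (i, .inr c) ∉ S}.ncard ≤ 1 := by
  refine (Set.ncard_le_one (Set.toFinite _)).2 fun c hc d hd => ?_
  by_contra h
  exact hS.2 _ hc _ hd (by simpa using h) (by simp only [closedNbhd_cliqueRing_inr])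

/-- If a location-dominating set misses both ports and an inner vertex of a clique, then it
contains the outer neighbours of the ports. -/
lemma IsLDSet.outer_mem (hS : IsLDSet (cliqueRing m s) S) {i : ZMod m} {c : Fin s}
    (hp : ∀ a, (i, .inl a) ∉ S) (hc : (i, .inr c) ∉ S) (a : Bool) :
    (i + portShift m a, .inl !a) ∈ S := by
  by_contra h
  refine hS.2 _ (hp a) _ hc (by simp) ?_
  rw [closedNbhd_cliqueRing_inr, closedNbhd, neighborSet_cliqueRing_inl]
  ext ⟨j, b | d⟩
  · simp only [Set.mem_inter_iff, Set.mem_insert_iff, Set.mem_range, Prod.mk.injEq,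
      Sum.inl.injEq, and_congr_left_iff]
    grind
  · simp

lemma IsLDSet.missed_consecutive_le (hS : IsLDSet (cliqueRing m s) S) (i : ZMod m) :
    missed S i + missed S (i + 1) + missed S (i + 2) ≤ 7 := by
  have key (j : ZMod m) : (j, .inl true) ∉ S → (j, .inl false) ∉ S →
      {c | (j, .inr c) ∉ S}.ncard = 1 →
      (j + 1, .inl false) ∈ S ∧ (j - 1, .inl true) ∈ S := by
    intro ht hf h
    obtain ⟨c, hc⟩ := Set.ncard_eq_one.1 h
    have hc' : (j, .inr c) ∉ S := hc.ge rfl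
    have := hS.outer_mem (Bool.forall_bool.2 ⟨hf, ht⟩) hc'
    exact ⟨this true, by simpa [portShift, sub_eq_add_neg] using this false⟩
  have e₁ : i + 1 + 1 = i + 2 := by ring
  have e₂ : i + 2 - 1 = i + 1 := by ring
  have e₃ : i + 1 - 1 = i := by ring
  have h₀ := key i
  have h₁ := key (i + 1)
  have h₂ := key (i + 2)
  rw [e₁, e₃] at h₁
  rw [e₂] at h₂
  have t₀ := hS.ncard_inr_notMem_le_one i
  have t₁ := hS.ncard_inr_notMem_le_one (i + 1)
  have t₂ := hS.ncard_inr_notMem_le_one (i + 2)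
  unfold missed
  generalize {c | (i, .inr c) ∉ S}.ncard = n₀ at *
  generalize {c | (i + 1, .inr c) ∉ S}.ncard = n₁ at *
  generalize {c | (i + 2, .inr c) ∉ S}.ncard = n₂ at *
  clear key e₁ e₂ e₃ hS
  grind

end LowerBound

section Optimal

variable (k q : ℕ)

/-- The residue modulo `3` of a position in a ring of `3 * k` cliques. -/
def residueThree : ZMod (3 * k) →+* ZMod 3 := ZMod.castHom (dvd_mul_right 3 k) (ZMod 3)

/-- An optimal locating-dominating set of a ring of `3 * k` cliques. -/
def optimalLDSet : Set (ZMod (3 * k) × (Bool ⊕ Fin (q + 2))) :=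
  {v | match v with
    | (i, .inl true) => residueThree k i = 2
    | (i, .inl false) => residueThree k i = 1
    | (_, .inr c) => c ≠ 0}

variable {k q}

@[simp]
lemma inl_true_mem_optimalLDSet {i : ZMod (3 * k)} :
    (i, .inl true) ∈ optimalLDSet k q ↔ residueThree k i = 2 := Iff.rfl

@[simp]
lemma inl_false_mem_optimalLDSet {i : ZMod (3 * k)} :
    (i, .inl false) ∈ optimalLDSet k q ↔ residueThree k i = 1 := Iff.rfl

@[simp]
lemma inr_mem_optimalLDSet {i : ZMod (3 * k)} {c : Fin (q + 2)} :
    (i, .inr c) ∈ optimalLDSet k q ↔ c ≠ 0 := Iff.rfl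

lemma missed_optimalLDSet_consecutive (i : ZMod (3 * k)) :
    missed (optimalLDSet k q) i + missed (optimalLDSet k q) (i + 1) +
      missed (optimalLDSet k q) (i + 2) = 7 := by
  have h : {c : Fin (q + 2) | c = 0}.ncard = 1 := Set.ncard_singleton 0
  simp only [missed, inl_true_mem_optimalLDSet, inl_false_mem_optimalLDSet, inr_mem_optimalLDSet,
    not_not, h, map_add, map_one, map_ofNat]
  generalize residueThree k i = x
  revert x
  decide

lemma outer_mem_optimalLDSet {i : ZMod (3 * k)} {a : Bool}
    (h : (i, .inl a) ∉ optimalLDSet k q) (h' : (i, .inl !a) ∉ optimalLDSet k q) :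
    (i + portShift (3 * k) a, .inl !a) ∈ optimalLDSet k q := by
  cases a <;>
  · simp only [Bool.not_true, Bool.not_false, inl_true_mem_optimalLDSet,
      inl_false_mem_optimalLDSet, portShift, map_add, map_neg, map_one] at h h' ⊢
    generalize residueThree k i = x at *
    revert x
    decide

lemma portShift_three_mul_ne_zero (a : Bool) : portShift (3 * k) a ≠ 0 := fun h => by
  have := congrArg (residueThree k) h
  cases a <;> simp [portShift] at this

lemma closedNbhd_inter_optimalLDSet_inl_ne_inr {i : ZMod (3 * k)} {a : Bool}
    (h : (i, .inl a) ∉ optimalLDSet k q) (c : Fin (q + 2)) :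
    closedNbhd (cliqueRing (3 * k) (q + 2)) (i, .inl a) ∩ optimalLDSet k q ≠
      closedNbhd (cliqueRing (3 * k) (q + 2)) (i, .inr c) ∩ optimalLDSet k q := by
  intro heq
  rw [closedNbhd_cliqueRing_inr, closedNbhd, neighborSet_cliqueRing_inl] at heq
  by_cases h' : (i, .inl !a) ∈ optimalLDSet k q
  · have := (heq.ge ⟨⟨_, rfl⟩, h'⟩).1
    simp [portShift_three_mul_ne_zero] at this
  · have := (heq.le ⟨Or.inr (Or.inl rfl), outer_mem_optimalLDSet h h'⟩).1
    simp [portShift_three_mul_ne_zero] at this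

lemma closedNbhd_inter_optimalLDSet_inl_ne_inl_not {i : ZMod (3 * k)} {a : Bool}
    (h : (i, .inl a) ∉ optimalLDSet k q) (h' : (i, .inl !a) ∉ optimalLDSet k q) :
    closedNbhd (cliqueRing (3 * k) (q + 2)) (i, .inl a) ∩ optimalLDSet k q ≠
      closedNbhd (cliqueRing (3 * k) (q + 2)) (i, .inl !a) ∩ optimalLDSet k q := by
  intro heq
  have := (heq.le ⟨Or.inr ?_, outer_mem_optimalLDSet h h'⟩).1
  · simp [closedNbhd, portShift_three_mul_ne_zero] at this
  · simp

lemma isLDSet_optimalLDSet : IsLDSet (cliqueRing (3 * k) (q + 2)) (optimalLDSet k q) := by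
  have mem_one (i : ZMod (3 * k)) (a : Bool ⊕ Fin (q + 2)) :
      (i, .inr 1) ∈ closedNbhd (cliqueRing (3 * k) (q + 2)) (i, a) ∩ optimalLDSet k q := by
    refine ⟨?_, by simp⟩
    rcases a with a | c
    · exact Or.inr rfl
    · rw [closedNbhd_cliqueRing_inr]
      exact ⟨_, rfl⟩
  refine ⟨fun ⟨i, a⟩ => ⟨_, mem_one i a⟩, fun ⟨i, a⟩ hu ⟨j, b⟩ hv huv heq => ?_⟩
  obtain rfl : i = j := by
    have := (heq.le (mem_one i a)).1
    rcases b with b | d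
    · simpa [closedNbhd, eq_comm] using this
    · rw [closedNbhd_cliqueRing_inr] at this
      simpa [eq_comm] using this
  rcases a with a | c <;> rcases b with b | d
  · obtain rfl : b = !a := by
      cases a <;> cases b <;> simp_all
    exact closedNbhd_inter_optimalLDSet_inl_ne_inl_not hu hv heq
  · exact closedNbhd_inter_optimalLDSet_inl_ne_inr hu d heq
  · exact closedNbhd_inter_optimalLDSet_inl_ne_inr hv c heq.symm
  · simp_all

end Optimal

lemma ldNum_cliqueRing {k q : ℕ} [NeZero k] :
    ldNum (cliqueRing (3 * k) (q + 2)) = (3 * q + 5) * k := by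
  refine IsLeast.csInf_eq ⟨⟨optimalLDSet k q, isLDSet_optimalLDSet, ?_⟩, ?_⟩
  · have h := sum_consecutive_triples (missed (optimalLDSet k q))
    simp only [missed_optimalLDSet_consecutive, Finset.sum_const, Finset.card_univ, ZMod.card,
      smul_eq_mul] at h
    have := ncard_add_sum_missed (optimalLDSet k q)
    linarith
  · rintro _ ⟨S, hS, rfl⟩
    have h := sum_consecutive_triples (missed S)
    have h' := Finset.sum_le_card_nsmul Finset.univ _ 7 fun i _ => hS.missed_consecutive_le i
    simp only [Finset.card_univ, ZMod.card, smul_eq_mul] at h'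
    have := ncard_add_sum_missed S
    linarith

end SimpleGraph

/-- For every `r ≥ 4` and positive `k` there exists a connected
`r`-regular graph on `n = (3r+3)k` vertices having closed twins, whose
location-domination number equals `(3r-4)n/(3r+3) = (3r-4)k`; in particular it
exceeds `n/2`. -/
theorem stmt12 (r k : ℕ) (hr : 4 ≤ r) (hk : 0 < k) :
    ∃ G : SimpleGraph (Fin ((3 * r + 3) * k)), G.Connected ∧
      (∀ v, deg G v = r) ∧
      (∃ u v : Fin ((3 * r + 3) * k), ClosedTwins G u v) ∧
      ldNum G = (3 * r - 4) * k ∧ 2 * ldNum G > (3 * r + 3) * k := by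
  obtain ⟨q, rfl⟩ : ∃ q, r = q + 3 := ⟨r - 3, by omega⟩
  have : NeZero k := ⟨hk.ne'⟩
  let e : ZMod (3 * k) × (Bool ⊕ Fin (q + 2)) ≃ Fin ((3 * (q + 3) + 3) * k) :=
    Fintype.equivFinOfCardEq (by simp [ZMod.card]; ring)
  let f := Iso.map e (cliqueRing (3 * k) (q + 2))
  have hld : ldNum ((cliqueRing (3 * k) (q + 2)).map e) = (3 * q + 5) * k := by
    rw [f.ldNum_eq, ldNum_cliqueRing]
  refine ⟨_, f.connected_iff.1 connected_cliqueRing, fun v => ?_,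
    ⟨_, _, f.closedTwins (closedTwins_cliqueRing 0 zero_ne_one)⟩, ?_, ?_⟩
  · obtain ⟨v, rfl⟩ := f.surjective v
    rw [f.deg_eq, deg_cliqueRing]
  · rw [hld]
    congr 1
  · rw [hld]
    nlinarith
end

section
/- Let G be a connected subcubic graph not isomorphic to K_{3,3}. Then for every vertex u of degree 3 in G there exists at most one vertex v ≠ u with N(v) = N(u); that is, each open twin of degree 3 has exactly one open-twin partner. -/
open SimpleGraph

/-- A graph in which two vertices are adjacent exactly when `B` contains one of them and not the
other is complete bipartite. -/
theorem nonempty_iso_completeBipartiteGraph {V : Type*} [Finite V] (G : SimpleGraph V) (B : Set V)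
    {m n : ℕ} (hB : B.ncard = m) (hBc : Bᶜ.ncard = n)
    (hadj : ∀ x y, G.Adj x y ↔ (x ∈ B ∧ y ∉ B) ∨ (x ∉ B ∧ y ∈ B)) :
    Nonempty (G ≃g completeBipartiteGraph (Fin m) (Fin n)) := by
  classical
  have e₁ : B ≃ Fin m := Finite.equivFinOfCardEq hB
  have e₂ : (Bᶜ : Set V) ≃ Fin n := Finite.equivFinOfCardEq hBc
  refine ⟨RelIso.symm ⟨(Equiv.sumCongr e₁ e₂).symm.trans (Equiv.Set.sumCompl B), ?_⟩⟩
  rintro (a | a) (b | b)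
  · have ha := (e₁.symm a).2
    have hb := (e₁.symm b).2
    simp [hadj, ha, hb]
  · have ha := (e₁.symm a).2
    have hb : (e₂.symm b : V) ∉ B := (e₂.symm b).2
    simp [hadj, ha, hb]
  · have ha : (e₂.symm a : V) ∉ B := (e₂.symm a).2
    have hb := (e₁.symm b).2
    simp [hadj, ha, hb]
  · have ha : (e₂.symm a : V) ∉ B := (e₂.symm a).2
    have hb : (e₂.symm b : V) ∉ B := (e₂.symm b).2
    simp [hadj, ha, hb]

/-- In a connected graph, a nonempty set closed under adjacency contains every vertex. -/
theorem SimpleGraph.Connected.mem_of_adj_closed {V : Type*} {G : SimpleGraph V}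
    (hconn : G.Connected) {S : Set V} {u : V} (hu : u ∈ S)
    (hS : ∀ x ∈ S, ∀ y, G.Adj x y → y ∈ S) (x : V) : x ∈ S := by
  obtain ⟨p⟩ := hconn.preconnected u x
  induction p with
  | nil => exact hu
  | cons h _ ih => exact ih (hS _ hu _ h)

/-- In a connected subcubic graph not isomorphic to `K_{3,3}`, every
vertex of degree 3 has at most one open-twin partner. -/
theorem stmt14 {V : Type*} [Fintype V] (G : SimpleGraph V)
    (hconn : G.Connected) (hsub : Subcubic G)
    (hK33 : ¬ Nonempty (G ≃g completeBipartiteGraph (Fin 3) (Fin 3)))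
    (u : V) (hu : deg G u = 3)
    (v w : V) (hv : v ≠ u) (hw : w ≠ u)
    (hvN : G.neighborSet v = G.neighborSet u)
    (hwN : G.neighborSet w = G.neighborSet u) :
    v = w := by
  by_contra hvw
  apply hK33
  set B : Set V := {u, v, w}
  have hBcard : B.ncard = 3 := Set.ncard_eq_three.mpr ⟨u, v, w, hv.symm, hw.symm, hvw, rfl⟩
  have hBN : ∀ b ∈ B, G.neighborSet b = G.neighborSet u := by
    rintro b (rfl | rfl | rfl)
    exacts [rfl, hvN, hwN]
  have hAN : ∀ a ∈ G.neighborSet u, G.neighborSet a = B := by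
    intro a ha
    refine (Set.eq_of_subset_of_ncard_le (fun b hb => ?_) (hBcard ▸ hsub a)
      (Set.toFinite _)).symm
    have h : a ∈ G.neighborSet b := hBN b hb ▸ ha
    exact G.adj_symm h
  have hdisj : ∀ b ∈ B, b ∉ G.neighborSet u := fun b hb h => by
    rw [← hBN b hb] at h
    exact G.irrefl h
  have hcover : ∀ x, x ∈ B ∪ G.neighborSet u := by
    refine hconn.mem_of_adj_closed (u := u) (Or.inl (Or.inl rfl)) ?_
    rintro x (hx | hx) y hxy
    · exact Or.inr (hBN x hx ▸ hxy)
    · exact Or.inl (hAN x hx ▸ hxy)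
  have hcompl : Bᶜ = G.neighborSet u :=
    Set.Subset.antisymm (fun x hx => (hcover x).resolve_left hx) fun x hx hxB => hdisj x hxB hx
  refine nonempty_iso_completeBipartiteGraph G B hBcard (hcompl ▸ hu) fun x y => ?_
  rw [← mem_neighborSet]
  by_cases hx : x ∈ B
  · simp [hBN x hx, ← hcompl, hx]
  · have hx' : x ∈ G.neighborSet u := hcompl ▸ hx
    simp [hAN x hx', hx]
end

section
/- There exists a connected cubic graph G on 10 vertices containing both open twins and closed twins such that γ^LD(G) = 5 = n/2 (namely the graph on vertices v0,…,v9 arranged in a 10-cycle with the five chords v0v3, v1v8, v9v2, v6v4, v5v7). -/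
open SimpleGraph

/-- The 10-vertex cubic graph: a 10-cycle `v0 v1 … v9` together with the chords
`v0v3, v1v8, v9v2, v6v4, v5v7`. -/
def G15 : SimpleGraph (Fin 10) :=
  SimpleGraph.fromEdgeSet
    {s(0, 1), s(1, 2), s(2, 3), s(3, 4), s(4, 5), s(5, 6), s(6, 7), s(7, 8),
     s(8, 9), s(9, 0), s(0, 3), s(1, 8), s(9, 2), s(6, 4), s(5, 7)}

/-- The open neighbourhoods of `G15` as finite sets. -/
def nbrs15 : Fin 10 → Finset (Fin 10) :=
  ![{1, 3, 9}, {0, 2, 8}, {1, 3, 9}, {0, 2, 4}, {3, 5, 6},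
    {4, 6, 7}, {4, 5, 7}, {5, 6, 8}, {1, 7, 9}, {0, 2, 8}]

theorem neighborSet_G15 (v : Fin 10) : G15.neighborSet v = nbrs15 v := by
  ext w
  simp only [G15, mem_neighborSet, fromEdgeSet_adj, Set.mem_insert_iff, Set.mem_singleton_iff,
    Finset.mem_coe]
  revert v w
  decide +kernel

theorem adj_G15_iff {v w : Fin 10} : G15.Adj v w ↔ w ∈ nbrs15 v := by
  rw [← mem_neighborSet, neighborSet_G15, Finset.mem_coe]

theorem closedNbhd_G15 (v : Fin 10) : closedNbhd G15 v = ↑(insert v (nbrs15 v)) := by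
  rw [closedNbhd, neighborSet_G15, Finset.coe_insert]

theorem isLDSet_G15_coe_iff (S : Finset (Fin 10)) :
    IsLDSet G15 S ↔ (∀ v, (insert v (nbrs15 v) ∩ S).Nonempty) ∧
      ∀ u ∉ S, ∀ v ∉ S, u ≠ v → insert u (nbrs15 u) ∩ S ≠ insert v (nbrs15 v) ∩ S := by
  simp only [IsLDSet, IsDominating, closedNbhd_G15, ← Finset.coe_inter, Finset.coe_nonempty,
    Finset.mem_coe, ne_eq, Finset.coe_inj]

theorem five_le_card_of_isLDSet_G15 (S : Finset (Fin 10)) (hS : IsLDSet G15 S) : 5 ≤ S.card := by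
  rw [isLDSet_G15_coe_iff] at hS
  revert S
  decide +kernel

theorem connected_G15 : G15.Connected := by
  have step : ∀ i : Fin 9, G15.Adj i.castSucc i.succ := by
    simp only [adj_G15_iff]
    decide
  have reach (v : Fin 10) : G15.Reachable 0 v := by
    induction v using Fin.induction with
    | zero => exact Reachable.refl 0
    | succ i ih => exact ih.trans (step i).reachable
  exact ⟨fun u v => (reach u).symm.trans (reach v)⟩

theorem deg_G15 (v : Fin 10) : deg G15 v = 3 := by
  rw [deg, neighborSet_G15, Set.ncard_coe_finset]
  revert v
  decide

theorem ldNum_G15 : ldNum G15 = 5 := by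
  have mem : 5 ∈ {k : ℕ | ∃ S : Set (Fin 10), IsLDSet G15 S ∧ S.ncard = k} := by
    refine ⟨({0, 1, 2, 4, 5} : Finset (Fin 10)), ?_, ?_⟩
    · rw [isLDSet_G15_coe_iff]
      decide +kernel
    · rw [Set.ncard_coe_finset]
      decide
  refine le_antisymm (Nat.sInf_le mem) (le_csInf ⟨5, mem⟩ ?_)
  rintro _ ⟨S, hS, rfl⟩
  lift S to Finset (Fin 10) using S.toFinite
  rw [Set.ncard_coe_finset]
  exact five_le_card_of_isLDSet_G15 S hS

/-- There is a connected cubic graph on 10 vertices (namely `G15`)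
containing both open twins and closed twins with `γ^LD(G) = 5 = n/2`. -/
theorem stmt15 :
    G15.Connected ∧ (∀ v : Fin 10, deg G15 v = 3) ∧
      (∃ u v : Fin 10, OpenTwins G15 u v) ∧
      (∃ u v : Fin 10, ClosedTwins G15 u v) ∧
      ldNum G15 = 5 := by
  refine ⟨connected_G15, deg_G15, ⟨0, 2, by decide, ?_⟩, ⟨5, 6, by decide, ?_⟩, ldNum_G15⟩
  · rw [neighborSet_G15, neighborSet_G15, Finset.coe_inj]
    decide
  · rw [closedNbhd_G15, closedNbhd_G15, Finset.coe_inj]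
    decide
end
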